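/- Let n ≥ 8 be an integer, let m > 2(n − 6) + 10 be an integer, and for any positive integer j define A(j) = 2(j − 2) + C(n−j+1, 2). Let r be an integer such that either (i) A(r+1) + 1 < m ≤ A(r) + 1 and 2 ≤ r < ⌊(n−2)/2⌋, or (ii) A(r+1) < m ≤ A(r) + 1 and r = ⌊(n−2)/2⌋, or (iii) A(r+1) < m ≤ A(r) and ⌊(n−2)/2⌋ < r ≤ n − 5. Then the maximum of γ_CR(G) over all finite simple graphs G of order n with m edges and CR(G) = 2 equals r. -/

import Mathlib

open SimpleGraph Set

/-- The closed neighborhood `N[v]` of a vertex `v`. -/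
def closedNbhd {V : Type*} (G : SimpleGraph V) (v : V) : Set V :=
  insert v (G.neighborSet v)

/-- `S` is a dominating set of `G`: every vertex lies in `N[s]` for some `s ∈ S`. -/
def IsDomSet {V : Type*} (G : SimpleGraph V) (S : Set V) : Prop :=
  ∀ v : V, ∃ s ∈ S, v ∈ closedNbhd G s

/-- `CR(S)`: the number of vertices overdominated by `S`, i.e. with `|N[x] ∩ S| ≥ 2`. -/
noncomputable def crOf {V : Type*} (G : SimpleGraph V) (S : Set V) : ℕ :=
  {x : V | 2 ≤ (closedNbhd G x ∩ S).ncard}.ncard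

/-- `CR(G)`: the minimum of `CR(S)` over all dominating sets `S` of `G`. -/
noncomputable def crNum {V : Type*} (G : SimpleGraph V) : ℕ :=
  sInf {k : ℕ | ∃ S : Set V, IsDomSet G S ∧ crOf G S = k}

/-- `γ_CR(G)`: the minimum cardinality of a dominating set `S` with `CR(S) = CR(G)`. -/
noncomputable def gammaCR {V : Type*} (G : SimpleGraph V) : ℕ :=
  sInf {r : ℕ | ∃ S : Set V, IsDomSet G S ∧ crOf G S = crNum G ∧ S.ncard = r}

/-- `IsMaxGamma n m M` : among all graphs of order `n` with `m` edges and
`CR(G) = 2`, the maximum value of `γ_CR(G)` is `M`. -/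
def IsMaxGamma (n m M : ℕ) : Prop :=
  (∀ (V : Type) [Fintype V] (G : SimpleGraph V), Fintype.card V = n →
      G.edgeSet.ncard = m → crNum G = 2 → gammaCR G ≤ M) ∧
  (∃ G : SimpleGraph (Fin n), G.edgeSet.ncard = m ∧ crNum G = 2 ∧ gammaCR G = M)

lemma choose_two_succ (a : ℕ) : (a + 1).choose 2 = a + a.choose 2 := by
  rw [Nat.choose_succ_succ', Nat.choose_one_right]

/-- `v` is overdominated by `S`, witnessed by two distinct elements of `S`. -/
def Overdominated {V : Type*} (G : SimpleGraph V) (S : Set V) (v : V) : Prop :=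
  ∃ a ∈ S, ∃ b ∈ S, a ≠ b ∧ (v = a ∨ G.Adj v a) ∧ (v = b ∨ G.Adj v b)

lemma mem_closedNbhd_iff {V : Type*} {G : SimpleGraph V} {u v : V} :
    u ∈ closedNbhd G v ↔ v = u ∨ G.Adj v u := by
  simp [closedNbhd, eq_comm]

lemma isDomSet_iff {V : Type*} {G : SimpleGraph V} {S : Set V} :
    IsDomSet G S ↔ ∀ v, ∃ s ∈ S, v = s ∨ G.Adj v s := by
  refine forall_congr' fun v => ?_
  simp_rw [mem_closedNbhd_iff, G.adj_comm v, eq_comm (a := v)]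

section Basic

variable {V : Type*} {G : SimpleGraph V}

lemma crNum_le {S : Set V} (hS : IsDomSet G S) : crNum G ≤ crOf G S :=
  Nat.sInf_le ⟨S, hS, rfl⟩

lemma gammaCR_le {S : Set V} (hS : IsDomSet G S) (h : crOf G S = crNum G) :
    gammaCR G ≤ S.ncard :=
  Nat.sInf_le ⟨S, hS, h, rfl⟩

variable (G) in
lemma exists_gammaCR_set :
    ∃ S : Set V, IsDomSet G S ∧ crOf G S = crNum G ∧ S.ncard = gammaCR G := by
  have h1 : ({k : ℕ | ∃ S : Set V, IsDomSet G S ∧ crOf G S = k}).Nonempty :=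
    ⟨_, Set.univ, fun v => ⟨v, trivial, mem_closedNbhd_iff.2 (.inl rfl)⟩, rfl⟩
  obtain ⟨S, hS, h⟩ := Nat.sInf_mem h1
  exact Nat.sInf_mem (s := {r : ℕ | ∃ S : Set V, IsDomSet G S ∧ crOf G S = crNum G ∧ S.ncard = r})
    ⟨_, S, hS, h, rfl⟩

/-- A certificate that `CR(G) = 2` and `γ_CR(G) = |S|`. -/
lemma gammaCR_eq_of_certificate {S : Set V} (hS : IsDomSet G S) (hc : crOf G S ≤ 2)
    (hT : ∀ T : Set V, IsDomSet G T → 3 ≤ crOf G T ∨ (2 ≤ crOf G T ∧ S.ncard ≤ T.ncard)) :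
    crNum G = 2 ∧ gammaCR G = S.ncard := by
  obtain ⟨T, hT1, hT2, hT3⟩ := exists_gammaCR_set G
  have h1 := hT S hS
  have h2 := hT T hT1
  have h3 := crNum_le hS
  have h4 : crNum G = 2 := by omega
  have h5 := gammaCR_le hS (by omega)
  exact ⟨h4, by omega⟩

variable [Finite V]

lemma overdominated_iff {S : Set V} {v : V} :
    Overdominated G S v ↔ 2 ≤ (closedNbhd G v ∩ S).ncard := by
  rw [show (2 ≤ (closedNbhd G v ∩ S).ncard) ↔ 1 < (closedNbhd G v ∩ S).ncard from Iff.rfl,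
    Set.one_lt_ncard]
  simp only [Overdominated, Set.mem_inter_iff, mem_closedNbhd_iff]
  constructor
  · rintro ⟨a, ha, b, hb, hab, h1, h2⟩
    exact ⟨a, ⟨h1, ha⟩, b, ⟨h2, hb⟩, hab⟩
  · rintro ⟨a, ⟨h1, ha⟩, b, ⟨h2, hb⟩, hab⟩
    exact ⟨a, ha, b, hb, hab, h1, h2⟩

lemma crOf_eq (S : Set V) : crOf G S = {v | Overdominated G S v}.ncard := by
  simp only [crOf, overdominated_iff]

lemma two_le_crOf {S : Set V} {a b : V} (hab : a ≠ b) (ha : Overdominated G S a)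
    (hb : Overdominated G S b) : 2 ≤ crOf G S := by
  rw [crOf_eq]
  exact (Set.one_lt_ncard).2 ⟨a, ha, b, hb, hab⟩

lemma three_le_crOf {S : Set V} {a b c : V} (hab : a ≠ b) (hac : a ≠ c) (hbc : b ≠ c)
    (ha : Overdominated G S a) (hb : Overdominated G S b) (hc : Overdominated G S c) :
    3 ≤ crOf G S := by
  rw [crOf_eq]
  exact (Set.two_lt_ncard).2 ⟨a, ha, b, hb, c, hc, hab, hac, hbc⟩

lemma crOf_le_two {S : Set V} {a b : V} (h : ∀ v, Overdominated G S v → v = a ∨ v = b) :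
    crOf G S ≤ 2 := by
  rw [crOf_eq]
  exact (Set.ncard_le_ncard (t := {a, b}) fun v hv => h v hv).trans <|
    (Set.ncard_insert_le a {b}).trans (by rw [Set.ncard_singleton])

lemma crNum_eq_zero_of_universal {x : V} (hx : ∀ v, v ≠ x → G.Adj v x) : crNum G = 0 := by
  have hd : IsDomSet G {x} := isDomSet_iff.2 fun v => ⟨x, rfl, or_iff_not_imp_left.2 (hx v)⟩
  have hc : crOf G {x} = 0 := by
    rw [crOf_eq, Set.ncard_eq_zero, Set.eq_empty_iff_forall_notMem]
    rintro v ⟨a, rfl, b, rfl, hab, -⟩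
    exact hab rfl
  exact Nat.le_zero.1 (hc ▸ crNum_le hd)

end Basic

section ExtremalEdges

variable {V : Type*} [Fintype V] [DecidableEq V]

/-- All pairs outside `S`, all pairs joining `x` or `y` to `S`, and the pairs joining any other
vertex `v` outside `S` to `f v`. -/
def extremalEdges (S : Finset V) (x y : V) (f : V → V) : Finset (Sym2 V) :=
  Sᶜ.offDiag.image (Function.uncurry Sym2.mk) ∪ ((Sᶜ \ {x, y}).image (fun v => s(v, f v)) ∪
    (S.image (fun u => s(x, u)) ∪ S.image (fun u => s(y, u))))

variable {S : Finset V} {x y : V} {f : V → V}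

lemma mem_extremalEdges {u v : V} : s(u, v) ∈ extremalEdges S x y f ↔
    (u ∉ S ∧ v ∉ S ∧ u ≠ v) ∨ (u ∉ S ∧ u ≠ x ∧ u ≠ y ∧ f u = v) ∨
    (v ∉ S ∧ v ≠ x ∧ v ≠ y ∧ f v = u) ∨ (u = x ∧ v ∈ S) ∨ (v = x ∧ u ∈ S) ∨
    (u = y ∧ v ∈ S) ∨ (v = y ∧ u ∈ S) := by
  simp only [extremalEdges, Finset.mem_union, Finset.mem_image, Finset.mem_offDiag, Prod.exists,
    Function.uncurry_apply_pair, Finset.mem_sdiff, Finset.mem_compl, Finset.mem_insert,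
    Finset.mem_singleton, Sym2.eq_iff]
  grind

lemma card_extremalEdges (hx : x ∉ S) (hy : y ∉ S) (hxy : x ≠ y) (hf : ∀ v, f v ∈ S) :
    (extremalEdges S x y f).card =
      (Fintype.card V - S.card).choose 2 + ((Fintype.card V - S.card - 2) + (S.card + S.card)) := by
  unfold extremalEdges
  rw [Finset.card_union_of_disjoint, Finset.card_union_of_disjoint, Finset.card_union_of_disjoint,
    Sym2.card_image_offDiag, Finset.card_image_of_injOn, Finset.card_image_of_injOn,
    Finset.card_image_of_injOn, Finset.card_compl, Finset.card_sdiff_of_subset, Finset.card_compl,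
    Finset.card_pair hxy]
  · intro v
    simp only [Finset.mem_insert, Finset.mem_singleton, Finset.mem_compl]
    grind
  · intro a ha b hb h
    simp only [Sym2.eq_iff] at h
    grind
  · intro a ha b hb h
    simp only [Sym2.eq_iff] at h
    grind
  · intro a ha b hb h
    simp only [Sym2.eq_iff, Finset.coe_sdiff, Finset.coe_compl, Set.mem_sdiff, Set.mem_compl_iff,
      Finset.mem_coe] at h ha hb
    grind
  all_goals
    rw [Finset.disjoint_left]
    intro e
    simp only [Finset.mem_union, Finset.mem_image, Finset.mem_offDiag, Prod.exists,
      Function.uncurry_apply_pair, Finset.mem_sdiff, Finset.mem_compl, Finset.mem_insert,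
      Finset.mem_singleton]
  · rintro ⟨a, ha, rfl⟩ ⟨b, hb, h⟩
    simp only [Sym2.eq_iff] at h
    grind
  · rintro ⟨a, ha, rfl⟩ (⟨b, hb, h⟩ | ⟨b, hb, h⟩)
    all_goals simp only [Sym2.eq_iff] at h
    all_goals grind
  · rintro ⟨a, b, ha, rfl⟩ (⟨b, hb, h⟩ | ⟨b, hb, h⟩ | ⟨b, hb, h⟩)
    all_goals simp only [Sym2.eq_iff] at h
    all_goals grind

end ExtremalEdges

section Constructions

variable {V : Type*} {G : SimpleGraph V} {S : Finset V} {x y : V} {f : V → V}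

/-- Apart from `x` and `y`, the vertices outside the independent set `S` form a clique, and each
such vertex `v` has `f v` as its only neighbor in `S`. -/
structure IsCliqueOver (G : SimpleGraph V) (S : Finset V) (x y : V) (f : V → V) : Prop where
  notMem_left : x ∉ S
  notMem_right : y ∉ S
  ne : x ≠ y
  map_mem : ∀ v, f v ∈ S
  independent : ∀ u ∈ S, ∀ v ∈ S, ¬ G.Adj u v
  adj_clique : ∀ z, z ∉ S → z ≠ x → z ≠ y → ∀ w, w ∉ S → w ≠ x → w ≠ y → z ≠ w → G.Adj z w
  adj_iff : ∀ z, z ∉ S → z ≠ x → z ≠ y → ∀ u ∈ S, G.Adj z u ↔ f z = u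

namespace IsCliqueOver

lemma isDomSet (h : IsCliqueOver G S x y f) {s : V} (hs : s ∈ S) (hxs : G.Adj x s)
    (hys : G.Adj y s) : IsDomSet G S := by
  rw [isDomSet_iff]
  intro v
  by_cases hv : v ∈ S
  · exact ⟨v, hv, .inl rfl⟩
  · by_cases hvx : v = x
    · exact ⟨s, hs, .inr (hvx ▸ hxs)⟩
    · by_cases hvy : v = y
      · exact ⟨s, hs, .inr (hvy ▸ hys)⟩
      · exact ⟨f v, h.map_mem v, .inr ((h.adj_iff v hv hvx hvy _ (h.map_mem v)).2 rfl)⟩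

lemma crOf_le_two [Finite V] (h : IsCliqueOver G S x y f) : crOf G S ≤ 2 := by
  refine _root_.crOf_le_two (a := x) (b := y) ?_
  rintro v ⟨p, hp, q, hq, hpq, hvp, hvq⟩
  simp only [Finset.mem_coe] at hp hq
  by_contra! hv
  by_cases hvS : v ∈ S
  · have := h.independent v hvS
    grind
  · have := h.adj_iff v hvS hv.1 hv.2
    grind

variable [Fintype V]

lemma exists_three (h : IsCliqueOver G S x y f) (hn : S.card + 5 ≤ Fintype.card V) :
    ∃ a b c, (a ∉ S ∧ a ≠ x ∧ a ≠ y) ∧ (b ∉ S ∧ b ≠ x ∧ b ≠ y) ∧ (c ∉ S ∧ c ≠ x ∧ c ≠ y) ∧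
      a ≠ b ∧ a ≠ c ∧ b ≠ c := by
  classical
  have hc : 2 < (Finset.univ \ insert x (insert y S)).card := by
    rw [Finset.card_sdiff_of_subset (Finset.subset_univ _), Finset.card_insert_of_notMem,
      Finset.card_insert_of_notMem h.notMem_right, Finset.card_univ]
    · omega
    · simp [h.notMem_left, h.ne]
  obtain ⟨a, ha, b, hb, c, hc, habc⟩ := Finset.two_lt_card.1 hc
  simp only [Finset.mem_sdiff, Finset.mem_univ, Finset.mem_insert, true_and, not_or] at ha hb hc
  exact ⟨a, b, c, by tauto, by tauto, by tauto, habc⟩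

lemma domSet_cases (h : IsCliqueOver G S x y f) (hn : S.card + 5 ≤ Fintype.card V)
    {T : Set V} (hT : IsDomSet G T) (hx : x ∉ T) (hy : y ∉ T) :
    3 ≤ crOf G T ∨ (S.card ≤ T.ncard ∧ ((∀ s ∈ S, s ∈ T) ∨
      ∃ t ∈ T, t ∉ S ∧ t ≠ x ∧ t ≠ y ∧ ∀ s ∈ S, s ≠ f t → s ∈ T)) := by
  classical
  rw [isDomSet_iff] at hT
  have hsd : ∀ s ∈ S, s ∈ T ∨ ∃ t ∈ T, (t ∉ S ∧ t ≠ x ∧ t ≠ y) ∧ f t = s := by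
    intro s hs
    obtain ⟨t, ht, rfl | hst⟩ := hT s
    · exact .inl ht
    · have htS : t ∉ S := fun htS => h.independent s hs t htS hst
      have htx : t ≠ x := fun h => hx (h ▸ ht)
      have hty : t ≠ y := fun h => hy (h ▸ ht)
      exact .inr ⟨t, ht, ⟨htS, htx, hty⟩, (h.adj_iff t htS htx hty s hs).1 hst.symm⟩
  by_cases h0 : ∃ t ∈ T, t ∉ S ∧ t ≠ x ∧ t ≠ y
  · obtain ⟨t, ht, htZ⟩ := h0
    by_cases h2 : ∃ t' ∈ T, t' ≠ t ∧ t' ∉ S ∧ t' ≠ x ∧ t' ≠ y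
    · left
      obtain ⟨t', ht', htt, htZ'⟩ := h2
      obtain ⟨a, b, c, ha, hb, hc, hab, hac, hbc⟩ := h.exists_three hn
      have key : ∀ a, (a ∉ S ∧ a ≠ x ∧ a ≠ y) → Overdominated G T a := fun a ha =>
        ⟨t, ht, t', ht', htt.symm,
          or_iff_not_imp_left.2 (h.adj_clique a ha.1 ha.2.1 ha.2.2 t htZ.1 htZ.2.1 htZ.2.2),
          or_iff_not_imp_left.2 (h.adj_clique a ha.1 ha.2.1 ha.2.2 t' htZ'.1 htZ'.2.1 htZ'.2.2)⟩
      exact three_le_crOf hab hac hbc (key a ha) (key b hb) (key c hc)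
    · have hsub : ∀ s ∈ S, s ≠ f t → s ∈ T := by
        intro s hs hst
        rcases hsd s hs with hsT | ⟨t', ht', htZ', rfl⟩
        · exact hsT
        · exact absurd ⟨t', ht', fun e => hst (e ▸ rfl), htZ'⟩ h2
      refine .inr ⟨?_, .inr ⟨t, ht, htZ.1, htZ.2.1, htZ.2.2, hsub⟩⟩
      have hcard : (insert t (S.erase (f t))).card = S.card := by
        rw [Finset.card_insert_of_notMem (by simp [htZ.1]), Finset.card_erase_add_one (h.map_mem t)]
      rw [← hcard, ← Set.ncard_coe_finset]
      refine Set.ncard_le_ncard ?_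
      intro s hs
      simp only [Finset.coe_insert, Finset.coe_erase, Set.mem_insert_iff, Set.mem_sdiff,
        Finset.mem_coe, Set.mem_singleton_iff] at hs
      rcases hs with rfl | ⟨hs, hst⟩
      exacts [ht, hsub s hs hst]
  · have hsub : ∀ s ∈ S, s ∈ T := by
      intro s hs
      rcases hsd s hs with hsT | ⟨t, ht, htZ, -⟩
      · exact hsT
      · exact absurd ⟨t, ht, htZ⟩ h0
    refine .inr ⟨?_, .inl hsub⟩
    rw [← Set.ncard_coe_finset]
    exact Set.ncard_le_ncard hsub

lemma gammaCR_eq_of_nonadj_pair (h : IsCliqueOver G S x y f) (hS : 2 ≤ S.card)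
    (hn : S.card + 5 ≤ Fintype.card V)
    (hsurj : ∀ s ∈ S, ∃ z, z ∉ S ∧ z ≠ x ∧ z ≠ y ∧ f z = s)
    (hxy : ¬ G.Adj x y) (hx : ∀ v, v ≠ x → v ≠ y → G.Adj v x)
    (hy : ∀ v, v ≠ x → v ≠ y → G.Adj v y) :
    crNum G = 2 ∧ gammaCR G = S.card := by
  obtain ⟨s1, h1, s2, h2, h12⟩ := Finset.one_lt_card.1 hS
  obtain ⟨a, b, c, ha, hb, hc, hab, hac, hbc⟩ := h.exists_three hn
  have hne : ∀ s ∈ S, s ≠ x ∧ s ≠ y := fun s hs =>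
    ⟨fun e => h.notMem_left (e ▸ hs), fun e => h.notMem_right (e ▸ hs)⟩
  have hS' : ∀ s ∈ S, G.Adj s x ∧ G.Adj s y := fun s hs =>
    ⟨hx s (hne s hs).1 (hne s hs).2, hy s (hne s hs).1 (hne s hs).2⟩
  -- a dominating set containing `p ∈ {x, y}` also contains some `t ≠ p` dominating the other one
  have key : ∀ p, (∀ v, v ≠ x → v ≠ y → G.Adj v p) → ∀ T : Set V, p ∈ T →
      ∀ t ∈ T, t ≠ p → 3 ≤ crOf G T := by
    intro p hp T hpT t ht htp
    by_cases htS : t ∈ S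
    · obtain ⟨z, hz, hzx, hzy, rfl⟩ := hsurj t htS
      have hzf := (h.adj_iff z hz hzx hzy _ htS).2 rfl
      have hft := hp (f z) (hne _ htS).1 (hne _ htS).2
      refine three_le_crOf (a := p) (b := f z) (c := z) htp.symm ?_ ?_
        ⟨p, hpT, f z, ht, htp.symm, .inl rfl, .inr hft.symm⟩
        ⟨p, hpT, f z, ht, htp.symm, .inr hft, .inl rfl⟩
        ⟨p, hpT, f z, ht, htp.symm, .inr (hp z hzx hzy), .inr hzf⟩
      · exact (hp z hzx hzy).ne'
      · exact hzf.ne'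
    · have ht' : ∀ v, (v ∉ S ∧ v ≠ x ∧ v ≠ y) → Overdominated G T v := by
        rintro v ⟨hv, hvx, hvy⟩
        refine ⟨p, hpT, t, ht, htp.symm, .inr (hp v hvx hvy), ?_⟩
        by_cases htx : t = x
        · exact .inr (htx ▸ hx v hvx hvy)
        by_cases hty : t = y
        · exact .inr (hty ▸ hy v hvx hvy)
        · exact or_iff_not_imp_left.2 (h.adj_clique v hv hvx hvy t htS htx hty)
      exact three_le_crOf hab hac hbc (ht' a ha) (ht' b hb) (ht' c hc)
  rw [← Set.ncard_coe_finset]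
  refine gammaCR_eq_of_certificate (h.isDomSet h1 (hS' s1 h1).1.symm (hS' s1 h1).2.symm)
    h.crOf_le_two fun T hT => ?_
  have hT' := isDomSet_iff.1 hT
  by_cases hxT : x ∈ T
  · obtain ⟨t, ht, hyt⟩ := hT' y
    refine .inl (key x hx T hxT t ht ?_)
    rintro rfl
    exact hyt.elim (fun e => h.ne e.symm) fun e => hxy e.symm
  by_cases hyT : y ∈ T
  · obtain ⟨t, ht, hxt⟩ := hT' x
    refine .inl (key y hy T hyT t ht ?_)
    rintro rfl
    exact hxt.elim h.ne hxy
  rw [Set.ncard_coe_finset]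
  refine (h.domSet_cases hn hT hxT hyT).imp_right fun ⟨hc, hcase⟩ => ⟨?_, hc⟩
  obtain ⟨p, hp, q, hq, hpq⟩ : ∃ p ∈ T, ∃ q ∈ T, p ≠ q := by
    rcases hcase with hsub | ⟨t, ht, htS, -, -, hsub⟩
    · exact ⟨s1, hsub s1 h1, s2, hsub s2 h2, h12⟩
    · by_cases hft : s1 = f t
      · exact ⟨t, ht, s2, hsub s2 h2 (hft ▸ h12.symm), fun e => htS (e ▸ h2)⟩
      · exact ⟨t, ht, s1, hsub s1 h1 hft, fun e => htS (e ▸ h1)⟩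
  have hne' : ∀ v ∈ T, v ≠ x ∧ v ≠ y := fun v hv => ⟨fun e => hxT (e ▸ hv), fun e => hyT (e ▸ hv)⟩
  have hp' := hne' p hp
  have hq' := hne' q hq
  exact two_le_crOf h.ne
    ⟨p, hp, q, hq, hpq, .inr (hx p hp'.1 hp'.2).symm, .inr (hx q hq'.1 hq'.2).symm⟩
    ⟨p, hp, q, hq, hpq, .inr (hy p hp'.1 hp'.2).symm, .inr (hy q hq'.1 hq'.2).symm⟩

lemma gammaCR_eq_of_adj_pair {z₀ s₁ s₂ e : V} {W : Finset V} (h : IsCliqueOver G S x y f)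
    (hn : S.card + 5 ≤ Fintype.card V) (h1 : s₁ ∈ S) (h2 : s₂ ∈ S) (h12 : s₁ ≠ s₂)
    (hz : z₀ ∉ S) (hzx : z₀ ≠ x) (hzy : z₀ ≠ y) (he : e ∈ W) (heS : e ∉ S) (hex : e ≠ x)
    (hey : e ≠ y) (hzW : z₀ ∉ W) (h1W : s₁ ∉ W) (h2W : s₂ ∉ W)
    (hfz : f z₀ = s₁) (hf : ∀ v, v ≠ z₀ → f v = s₂)
    (hxy : G.Adj x y) (hx : ∀ v, v ≠ x → v ≠ y → (G.Adj v x ↔ v ≠ z₀))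
    (hy : ∀ v, v ≠ x → v ≠ y → (G.Adj v y ↔ v ∉ W)) :
    crNum G = 2 ∧ gammaCR G = S.card := by
  obtain ⟨a, b, ha, hb, hab, haz, hbz⟩ : ∃ a b, (a ∉ S ∧ a ≠ x ∧ a ≠ y) ∧
      (b ∉ S ∧ b ≠ x ∧ b ≠ y) ∧ a ≠ b ∧ a ≠ z₀ ∧ b ≠ z₀ := by
    obtain ⟨a, b, c, ha, hb, hc, hab, hac, hbc⟩ := h.exists_three hn
    by_cases haz : a = z₀
    · exact ⟨b, c, hb, hc, hbc, fun e => hab (haz.trans e.symm), fun e => hac (haz.trans e.symm)⟩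
    · by_cases hbz : b = z₀
      · exact ⟨a, c, ha, hc, hac, haz, fun e => hbc (hbz.trans e.symm)⟩
      · exact ⟨a, b, ha, hb, hab, haz, hbz⟩
  have hne : ∀ s ∈ S, s ≠ x ∧ s ≠ y ∧ s ≠ z₀ := fun s hs =>
    ⟨fun e => h.notMem_left (e ▸ hs), fun e => h.notMem_right (e ▸ hs), fun e => hz (e ▸ hs)⟩
  have hxS : ∀ s ∈ S, G.Adj s x := fun s hs => (hx s (hne s hs).1 (hne s hs).2.1).2 (hne s hs).2.2
  have hy1 : G.Adj s₁ y := (hy s₁ (hne s₁ h1).1 (hne s₁ h1).2.1).2 h1W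
  have hy2 : G.Adj s₂ y := (hy s₂ (hne s₂ h2).1 (hne s₂ h2).2.1).2 h2W
  have hyz : G.Adj z₀ y := (hy z₀ hzx hzy).2 hzW
  have hfz' : G.Adj z₀ s₁ := (h.adj_iff z₀ hz hzx hzy s₁ h1).2 hfz
  have hfv : ∀ v, v ∉ S → v ≠ x → v ≠ y → v ≠ z₀ → G.Adj v s₂ := fun v hv hvx hvy hvz =>
    (h.adj_iff v hv hvx hvy s₂ h2).2 (hf v hvz)
  have hzv : ∀ v, v ∉ S → v ≠ x → v ≠ y → v ≠ z₀ → G.Adj v z₀ := fun v hv hvx hvy hvz =>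
    h.adj_clique v hv hvx hvy z₀ hz hzx hzy hvz
  have hxv : ∀ v, v ≠ x → v ≠ y → v ≠ z₀ → G.Adj v x := fun v hvx hvy => (hx v hvx hvy).2
  rw [← Set.ncard_coe_finset]
  refine gammaCR_eq_of_certificate (h.isDomSet h1 (hxS s₁ h1).symm hy1.symm)
    h.crOf_le_two fun T hT => ?_
  have hT' := isDomSet_iff.1 hT
  by_cases hxT : x ∈ T
  · left
    by_cases hyT : y ∈ T
    · have hxy' := h.ne
      exact three_le_crOf h.ne (hne s₁ h1).1.symm (hne s₁ h1).2.1.symm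
        ⟨x, hxT, y, hyT, hxy', .inl rfl, .inr hxy⟩ ⟨x, hxT, y, hyT, hxy', .inr hxy.symm, .inl rfl⟩
        ⟨x, hxT, y, hyT, hxy', .inr (hxS s₁ h1), .inr hy1⟩
    obtain ⟨t, ht, hzt⟩ := hT' z₀
    have hty : t ≠ y := fun e => hyT (e ▸ ht)
    have htx : t ≠ x := by
      rintro rfl
      exact hzt.elim hzx fun e => (hx z₀ hzx hzy).1 e rfl
    by_cases htS : t ∈ S
    · obtain rfl : s₁ = t := by
        rw [← hfz]
        exact (h.adj_iff z₀ hz hzx hzy t htS).1 (hzt.resolve_left fun e => hz (e ▸ htS))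
      exact three_le_crOf htx.symm h.ne hty
        ⟨x, hxT, s₁, ht, htx.symm, .inl rfl, .inr (hxS s₁ h1).symm⟩
        ⟨x, hxT, s₁, ht, htx.symm, .inr (hxS s₁ h1), .inl rfl⟩
        ⟨x, hxT, s₁, ht, htx.symm, .inr hxy.symm, .inr hy1.symm⟩
    · by_cases htz : t = z₀
      · subst htz
        have key : ∀ v, (v ∉ S ∧ v ≠ x ∧ v ≠ y) → v ≠ t → Overdominated G T v := fun v hv hvt =>
          ⟨x, hxT, t, ht, htx.symm, .inr (hxv v hv.2.1 hv.2.2 hvt),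
            .inr (hzv v hv.1 hv.2.1 hv.2.2 hvt)⟩
        exact three_le_crOf hab (fun e => ha.1 (e ▸ h1)) (fun e => hb.1 (e ▸ h1)) (key a ha haz)
          (key b hb hbz) ⟨x, hxT, t, ht, htx.symm, .inr (hxS s₁ h1), .inr hfz'.symm⟩
      · have htx' := hxv t htx hty htz
        exact three_le_crOf htx.symm (hne s₂ h2).1.symm (fun e => htS (e ▸ h2))
          ⟨x, hxT, t, ht, htx.symm, .inl rfl, .inr htx'.symm⟩
          ⟨x, hxT, t, ht, htx.symm, .inr htx', .inl rfl⟩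
          ⟨x, hxT, t, ht, htx.symm, .inr (hxS s₂ h2), .inr (hfv t htS htx hty htz).symm⟩
  by_cases hyT : y ∈ T
  · left
    obtain ⟨t, ht, het⟩ := hT' e
    have htx : t ≠ x := fun e => hxT (e ▸ ht)
    have hty : t ≠ y := by
      rintro rfl
      exact het.elim hey fun h' => (hy e hex hey).1 h' he
    have hez : e ≠ z₀ := fun h => hzW (h ▸ he)
    by_cases htS : t ∈ S
    · obtain rfl : s₂ = t := by
        rw [← hf e hez]
        exact (h.adj_iff e heS hex hey t htS).1 (het.resolve_left fun e => heS (e ▸ htS))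
      exact three_le_crOf hty.symm h.ne.symm htx
        ⟨y, hyT, s₂, ht, hty.symm, .inl rfl, .inr hy2.symm⟩
        ⟨y, hyT, s₂, ht, hty.symm, .inr hy2, .inl rfl⟩
        ⟨y, hyT, s₂, ht, hty.symm, .inr hxy, .inr (hxS s₂ h2).symm⟩
    · by_cases htz : t = z₀
      · subst htz
        exact three_le_crOf hty.symm (hne s₁ h1).2.1.symm hfz'.ne
          ⟨y, hyT, t, ht, hty.symm, .inl rfl, .inr hyz.symm⟩
          ⟨y, hyT, t, ht, hty.symm, .inr hyz, .inl rfl⟩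
          ⟨y, hyT, t, ht, hty.symm, .inr hy1, .inr hfz'.symm⟩
      · exact three_le_crOf (hne s₂ h2).1.symm hzx.symm (hne s₂ h2).2.2
          ⟨y, hyT, t, ht, hty.symm, .inr hxy, .inr (hxv t htx hty htz).symm⟩
          ⟨y, hyT, t, ht, hty.symm, .inr hy2, .inr (hfv t htS htx hty htz).symm⟩
          ⟨y, hyT, t, ht, hty.symm, .inr hyz, .inr (hzv t htS htx hty htz).symm⟩
  rw [Set.ncard_coe_finset]
  refine (h.domSet_cases hn hT hxT hyT).imp_right fun ⟨hc, hcase⟩ => ⟨?_, hc⟩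
  rcases hcase with hsub | ⟨t, ht, htS, htx, hty, hsub⟩
  · exact two_le_crOf h.ne
      ⟨s₁, hsub s₁ h1, s₂, hsub s₂ h2, h12, .inr (hxS s₁ h1).symm, .inr (hxS s₂ h2).symm⟩
      ⟨s₁, hsub s₁ h1, s₂, hsub s₂ h2, h12, .inr hy1.symm, .inr hy2.symm⟩
  · by_cases htz : t = z₀
    · subst htz
      have hs := hsub s₂ h2 (hfz ▸ h12.symm)
      have key : ∀ v, (v ∉ S ∧ v ≠ x ∧ v ≠ y) → v ≠ t → Overdominated G T v := fun v hv hvt =>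
        ⟨t, ht, s₂, hs, (hne s₂ h2).2.2.symm, .inr (hzv v hv.1 hv.2.1 hv.2.2 hvt),
          .inr (hfv v hv.1 hv.2.1 hv.2.2 hvt)⟩
      exact two_le_crOf hab (key a ha haz) (key b hb hbz)
    · have hs := hsub s₁ h1 (hf t htz ▸ h12)
      have hts : t ≠ s₁ := fun e => htS (e ▸ h1)
      exact two_le_crOf hzx
        ⟨t, ht, s₁, hs, hts, .inr (hzv t htS htx hty htz).symm, .inr hfz'⟩
        ⟨t, ht, s₁, hs, hts, .inr (hxv t htx hty htz).symm, .inr (hxS s₁ h1).symm⟩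

end IsCliqueOver

end Constructions

section Existence

variable {V : Type*} [Fintype V] [DecidableEq V] {S : Finset V} {x y : V} {f : V → V}

lemma ne_of_mem_extremalEdges (hx : x ∉ S) (hy : y ∉ S) (hf : ∀ v, f v ∈ S) {u v : V}
    (h : s(u, v) ∈ extremalEdges S x y f) : u ≠ v := by
  rw [mem_extremalEdges] at h
  rintro rfl
  have := hf u
  grind

lemma edgeSet_ncard_fromEdgeSet_sdiff (hx : x ∉ S) (hy : y ∉ S) (hf : ∀ v, f v ∈ S)
    {F : Finset (Sym2 V)} (hF : F ⊆ extremalEdges S x y f) :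
    (fromEdgeSet (↑(extremalEdges S x y f \ F) : Set (Sym2 V))).edgeSet.ncard + F.card =
      (extremalEdges S x y f).card := by
  have h : (fromEdgeSet (↑(extremalEdges S x y f \ F) : Set (Sym2 V))).edgeSet =
      ↑(extremalEdges S x y f \ F) := by
    rw [edgeSet_fromEdgeSet, sdiff_eq_left, Set.disjoint_left]
    intro e
    induction e with
    | h u v =>
      intro he
      exact ne_of_mem_extremalEdges hx hy hf (Finset.mem_sdiff.1 he).1
  rw [h, Set.ncard_coe_finset, Finset.card_sdiff_add_card_eq_card hF]

lemma adj_fromEdgeSet_sdiff_iff (hx : x ∉ S) (hy : y ∉ S) (hf : ∀ v, f v ∈ S)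
    {F : Finset (Sym2 V)} {u v : V} :
    (fromEdgeSet (↑(extremalEdges S x y f \ F) : Set (Sym2 V))).Adj u v ↔
      s(u, v) ∈ extremalEdges S x y f ∧ s(u, v) ∉ F := by
  rw [fromEdgeSet_adj, Finset.mem_coe, Finset.mem_sdiff, and_iff_left_iff_imp]
  exact fun h => ne_of_mem_extremalEdges hx hy hf h.1

lemma isCliqueOver_fromEdgeSet_sdiff (hx : x ∉ S) (hy : y ∉ S) (hxy : x ≠ y)
    (hf : ∀ v, f v ∈ S) {F : Finset (Sym2 V)}
    (hF : ∀ u v, s(u, v) ∈ F → u = x ∨ u = y ∨ v = x ∨ v = y) :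
    IsCliqueOver (fromEdgeSet (↑(extremalEdges S x y f \ F) : Set (Sym2 V))) S x y f where
  notMem_left := hx
  notMem_right := hy
  ne := hxy
  map_mem := hf
  independent u hu v hv := by
    rw [adj_fromEdgeSet_sdiff_iff hx hy hf, mem_extremalEdges]
    grind
  adj_clique z hz hzx hzy w hw hwx hwy hzw := by
    rw [adj_fromEdgeSet_sdiff_iff hx hy hf, mem_extremalEdges]
    grind
  adj_iff z hz hzx hzy u hu := by
    rw [adj_fromEdgeSet_sdiff_iff hx hy hf, mem_extremalEdges]
    grind

lemma exists_graph_nonadj_pair (hx : x ∉ S) (hy : y ∉ S) (hxy : x ≠ y) (hf : ∀ v, f v ∈ S)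
    (hS : 2 ≤ S.card) (hn : S.card + 5 ≤ Fintype.card V)
    (hsurj : ∀ s ∈ S, ∃ z, z ∉ S ∧ z ≠ x ∧ z ≠ y ∧ f z = s) :
    ∃ G : SimpleGraph V, G.edgeSet.ncard + 1 = (extremalEdges S x y f).card ∧
      crNum G = 2 ∧ gammaCR G = S.card := by
  refine ⟨fromEdgeSet ↑(extremalEdges S x y f \ {s(x, y)}), ?_, ?_⟩
  · rw [← edgeSet_ncard_fromEdgeSet_sdiff hx hy hf (F := {s(x, y)}), Finset.card_singleton]
    rw [Finset.singleton_subset_iff, mem_extremalEdges]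
    exact .inl ⟨hx, hy, hxy⟩
  · refine (isCliqueOver_fromEdgeSet_sdiff hx hy hxy hf ?_).gammaCR_eq_of_nonadj_pair hS hn hsurj
      ?_ ?_ ?_
    · intro u v
      rw [Finset.mem_singleton, Sym2.eq_iff]
      tauto
    all_goals simp only [adj_fromEdgeSet_sdiff_iff hx hy hf, mem_extremalEdges,
      Finset.mem_singleton, Sym2.eq_iff]
    all_goals grind

lemma exists_graph_adj_pair {z₀ s₁ s₂ e : V} {W : Finset V} (hx : x ∉ S) (hy : y ∉ S)
    (hxy : x ≠ y) (hn : S.card + 5 ≤ Fintype.card V) (h1 : s₁ ∈ S) (h2 : s₂ ∈ S) (h12 : s₁ ≠ s₂)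
    (hz : z₀ ∉ S) (hzx : z₀ ≠ x) (hzy : z₀ ≠ y) (he : e ∈ W) (heS : e ∉ S)
    (hxW : x ∉ W) (hyW : y ∉ W) (hzW : z₀ ∉ W) (h1W : s₁ ∉ W) (h2W : s₂ ∉ W) :
    ∃ G : SimpleGraph V, G.edgeSet.ncard + (1 + W.card) =
      (extremalEdges S x y (fun v => if v = z₀ then s₁ else s₂)).card ∧
      crNum G = 2 ∧ gammaCR G = S.card := by
  have hf : ∀ v, (fun v => if v = z₀ then s₁ else s₂) v ∈ S := by
    intro v
    dsimp only
    split_ifs <;> assumption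
  set F : Finset (Sym2 V) := insert s(x, z₀) (W.image fun w => s(y, w)) with hFdef
  have hF : ∀ u v, s(u, v) ∈ F ↔ (u = x ∧ v = z₀ ∨ u = z₀ ∧ v = x) ∨
      (u = y ∧ v ∈ W) ∨ (v = y ∧ u ∈ W) := by
    intro u v
    simp only [hFdef, Finset.mem_insert, Finset.mem_image, Sym2.eq_iff]
    grind
  refine ⟨fromEdgeSet ↑(extremalEdges S x y (fun v => if v = z₀ then s₁ else s₂) \ F), ?_, ?_⟩
  · rw [← edgeSet_ncard_fromEdgeSet_sdiff hx hy hf (F := F), hFdef, Finset.card_insert_of_notMem,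
      Finset.card_image_of_injective, add_comm 1]
    · intro a b hab
      simp only [Sym2.eq_iff] at hab
      grind
    · simp only [Finset.mem_image, Sym2.eq_iff]
      grind
    · intro e
      induction e with
      | h u v =>
        rw [hF, mem_extremalEdges]
        grind
  · refine (isCliqueOver_fromEdgeSet_sdiff hx hy hxy hf ?_).gammaCR_eq_of_adj_pair hn h1 h2 h12
      hz hzx hzy he heS (fun e => hxW (e ▸ he)) (fun e => hyW (e ▸ he)) hzW h1W h2W
      (if_pos rfl) (fun v hv => if_neg hv) ?_ ?_ ?_
    · intro u v
      rw [hF]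
      tauto
    all_goals simp only [adj_fromEdgeSet_sdiff_iff hx hy hf, mem_extremalEdges, hF]
    all_goals grind

end Existence

section UpperBound

variable {V : Type*} [Fintype V] {G : SimpleGraph V}

lemma gammaCR_le_two_of_nonadj_pair (hG : crNum G = 2) {x y s : V} (hsy : G.Adj s y)
    (hs : ∀ v, G.Adj s v → v = x ∨ v = y) (hxy : ¬ G.Adj x y)
    (hx : ∀ v, v ≠ x → v ≠ y → G.Adj v x) : gammaCR G ≤ 2 := by
  have hd : IsDomSet G {x, s} := by
    rw [isDomSet_iff]
    intro v
    by_cases hvx : v = x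
    · exact ⟨x, by simp, .inl hvx⟩
    · by_cases hvy : v = y
      · exact ⟨s, by simp, .inr (hvy ▸ hsy.symm)⟩
      · exact ⟨x, by simp, .inr (hx v hvx hvy)⟩
  have hc : crOf G {x, s} ≤ 2 := by
    refine crOf_le_two (a := x) (b := s) ?_
    rintro v ⟨p, hp, q, hq, hpq, hvp, hvq⟩
    simp only [Set.mem_insert_iff, Set.mem_singleton_iff] at hp hq
    have h1 := hs v
    have h2 := G.adj_comm v s
    have h3 := G.adj_comm x y
    grind
  have h := crNum_le hd
  exact (gammaCR_le hd (by omega)).trans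
    ((Set.ncard_insert_le x {s}).trans (by rw [Set.ncard_singleton]))

lemma ncard_edgeSet_add_card_le {X M : Finset (Sym2 V)} (hX : ∀ u v, G.Adj u v → s(u, v) ∈ X)
    (hM : M ⊆ X) (hMG : ∀ e ∈ M, e ∉ G.edgeSet) : G.edgeSet.ncard + M.card ≤ X.card := by
  classical
  rw [← Finset.card_sdiff_add_card_eq_card hM, add_le_add_iff_right, ← Set.ncard_coe_finset]
  refine Set.ncard_le_ncard ?_
  intro e
  induction e with
  | h u v =>
    intro he
    exact Finset.mem_sdiff.2 ⟨hX u v he, fun h => hMG _ h he⟩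

lemma ncard_edgeSet_le_of_independent [DecidableEq V] (hG : crNum G = 2) {S : Finset V}
    {x y : V} {f : V → V} (hS : S.card = gammaCR G) (hS3 : 3 ≤ S.card) (hxy : x ≠ y)
    (hx : x ∉ S) (hy : y ∉ S)
    (hind : ∀ u ∈ S, ∀ v ∈ S, ¬ G.Adj u v)
    (huniq : ∀ v, v ∉ S → v ≠ x → v ≠ y → ∀ s ∈ S, G.Adj v s → f v = s) :
    G.edgeSet.ncard + 1 ≤ (extremalEdges S x y f).card ∧
      (Fintype.card V < 2 * S.card + 2 →
        G.edgeSet.ncard + 2 ≤ (extremalEdges S x y f).card) := by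
  have hX : ∀ u v, G.Adj u v → s(u, v) ∈ extremalEdges S x y f := by
    intro u v huv
    have h1 := hind u
    have h2 := huniq u
    have h3 := huniq v
    have h4 := huv.symm
    have h5 := huv.ne
    rw [mem_extremalEdges]
    grind
  have hcard := fun (M : Finset (Sym2 V)) => ncard_edgeSet_add_card_le (M := M) hX
  have hnon : ∀ p, ∃ q, q ≠ p ∧ ¬ G.Adj q p := by
    intro p
    by_contra! h
    have := crNum_eq_zero_of_universal h
    omega
  have hmem : ∀ p q, p ≠ q → (p = x ∨ p = y) → s(p, q) ∈ extremalEdges S x y f := by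
    intro p q hpq hp
    rw [mem_extremalEdges]
    grind
  obtain ⟨p, hpx, hp⟩ := hnon x
  obtain ⟨q, hqy, hq⟩ := hnon y
  have hxp := hmem x p hpx.symm (.inl rfl)
  have hyq := hmem y q hqy.symm (.inr rfl)
  refine ⟨?_, fun hbig => ?_⟩
  · have := hcard {s(x, p)} (by simpa using hxp) (by simpa using fun h => hp h.symm)
    simpa using this
  · by_contra! hlt
    have hone : ∀ a b c d, s(a, b) ∈ extremalEdges S x y f → s(c, d) ∈ extremalEdges S x y f →
        ¬ G.Adj a b → ¬ G.Adj c d → s(a, b) = s(c, d) := by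
      intro a b c d h1 h2 h3 h4
      by_contra hne
      have := hcard {s(a, b), s(c, d)} (by
        intro e he
        rw [Finset.mem_insert, Finset.mem_singleton] at he
        rcases he with rfl | rfl <;> assumption) (by
        intro e he
        rw [Finset.mem_insert, Finset.mem_singleton] at he
        rcases he with rfl | rfl <;> assumption)
      rw [Finset.card_pair hne] at this
      omega
    have hp' : ¬ G.Adj x p := fun h => hp h.symm
    have hq' : ¬ G.Adj y q := fun h => hq h.symm
    have hpy : p = y := by
      have := hone x p y q hxp hyq hp' hq'
      rw [Sym2.eq_iff] at this
      grind
    subst hpy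
    have hfull : ∀ v, v ≠ x → v ≠ p → G.Adj v x ∧ G.Adj v p := by
      intro v hvx hvp
      by_contra hv
      have h1 := hone x p x v hxp (hmem x v hvx.symm (.inl rfl)) hp'
      have h2 := hone x p p v hxp (hmem p v hvp.symm (.inr rfl)) hp'
      rw [Sym2.eq_iff] at h1 h2
      rw [G.adj_comm v x, G.adj_comm v p] at hv
      grind
    obtain ⟨s, hsS, hs⟩ : ∃ s ∈ S, s ∉ (Sᶜ \ {x, p}).image f := by
      by_contra! h
      have h1 := (Finset.card_le_card h).trans Finset.card_image_le
      rw [Finset.card_sdiff_of_subset, Finset.card_compl, Finset.card_pair hxy] at h1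
      · omega
      · intro v
        simp only [Finset.mem_insert, Finset.mem_singleton, Finset.mem_compl]
        grind
    have hsx : s ≠ x := fun e => hx (e ▸ hsS)
    have hsp : s ≠ p := fun e => hy (e ▸ hsS)
    have := gammaCR_le_two_of_nonadj_pair hG (hfull s hsx hsp).2 (fun v hv => by
      by_contra! hne
      refine hs (Finset.mem_image.2 ⟨v, ?_, ?_⟩)
      · simp only [Finset.mem_sdiff, Finset.mem_compl, Finset.mem_insert, Finset.mem_singleton,
          not_or]
        exact ⟨fun h => hind s hsS v h hv, hne⟩
      · exact huniq v (fun h => hind s hsS v h hv) hne.1 hne.2 s hsS hv.symm) hp'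
      (fun v h1 h2 => (hfull v h1 h2).1)
    omega

lemma ncard_edgeSet_le_of_adj_pair {S : Finset V} {x y : V} {f : V → V}
    (hpair : ∀ u ∈ S, ∀ v ∈ S, G.Adj u v → s(u, v) = s(x, y))
    (huniq : ∀ v, v ∉ S → ∀ s ∈ S, G.Adj v s → f v = s) :
    G.edgeSet.ncard ≤ (Fintype.card V - S.card + 1).choose 2 + 1 := by
  classical
  have h := ncard_edgeSet_add_card_le (G := G) (M := ∅)
    (X := insert s(x, y) (Sᶜ.offDiag.image (Function.uncurry Sym2.mk) ∪
      Sᶜ.image (fun v => s(v, f v)))) (fun u v huv => by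
      by_cases hu : u ∈ S
      · by_cases hv : v ∈ S
        · rw [hpair u hu v hv huv]
          exact Finset.mem_insert_self _ _
        · refine Finset.mem_insert_of_mem (Finset.mem_union_right _ (Finset.mem_image.2
            ⟨v, Finset.mem_compl.2 hv, ?_⟩))
          rw [huniq v hv u hu huv.symm, Sym2.eq_swap]
      · by_cases hv : v ∈ S
        · refine Finset.mem_insert_of_mem (Finset.mem_union_right _ (Finset.mem_image.2
            ⟨u, Finset.mem_compl.2 hu, ?_⟩))
          rw [huniq u hu v hv huv]
        · exact Finset.mem_insert_of_mem (Finset.mem_union_left _ (Finset.mem_image.2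
            ⟨(u, v), Finset.mem_offDiag.2 ⟨Finset.mem_compl.2 hu, Finset.mem_compl.2 hv, huv.ne⟩,
              rfl⟩))) (Finset.empty_subset _) (by simp)
  rw [Finset.card_empty, add_zero] at h
  refine h.trans ((Finset.card_insert_le _ _).trans (Nat.succ_le_succ ?_))
  refine (Finset.card_union_le _ _).trans ?_
  rw [Sym2.card_image_offDiag, choose_two_succ, add_comm, Finset.card_compl]
  exact Nat.add_le_add_right (Finset.card_image_le.trans (Finset.card_compl S).le) _

/-- Edge bounds for a graph with `CR(G) = 2` in terms of `γ_CR(G)`. -/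
lemma ncard_edgeSet_le_of_crNum_eq_two (hG : crNum G = 2) (h3 : 3 ≤ gammaCR G) :
    gammaCR G ≤ Fintype.card V ∧
    ((gammaCR G + 2 ≤ Fintype.card V ∧
      G.edgeSet.ncard ≤
        2 * (gammaCR G - 2) + (Fintype.card V - gammaCR G + 1).choose 2 + 1 ∧
      (Fintype.card V < 2 * gammaCR G + 2 → G.edgeSet.ncard ≤
        2 * (gammaCR G - 2) + (Fintype.card V - gammaCR G + 1).choose 2)) ∨
    G.edgeSet.ncard ≤ (Fintype.card V - gammaCR G + 1).choose 2 + 1) := by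
  classical
  obtain ⟨T, hT, hTc, hTn⟩ := exists_gammaCR_set G
  lift T to Finset V using T.toFinite
  rw [Set.ncard_coe_finset] at hTn
  rw [hG, crOf_eq, Set.ncard_eq_two] at hTc
  obtain ⟨x, y, hxy, hover⟩ := hTc
  have hover' : ∀ v, Overdominated G T v ↔ v = x ∨ v = y := fun v => by
    simpa using Set.ext_iff.1 hover v
  choose f hf hfadj using isDomSet_iff.1 hT
  have huniq : ∀ v, v ∉ T → v ≠ x → v ≠ y → ∀ s ∈ T, G.Adj v s → f v = s := by
    intro v _ hvx hvy s hs hvs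
    by_contra hne
    exact ((hover' v).1 ⟨f v, hf v, s, hs, hne, hfadj v, .inr hvs⟩).elim hvx hvy
  rw [← hTn] at h3 ⊢
  refine ⟨Finset.card_le_univ T, ?_⟩
  by_cases hind : ∀ u ∈ T, ∀ v ∈ T, ¬ G.Adj u v
  · left
    have hnot : ∀ v, Overdominated G T v → v ∉ T := by
      rintro v ⟨a, ha, b, hb, hab, hva, hvb⟩ hv
      rcases hva with rfl | hva
      · exact hvb.elim hab (hind v hv b hb)
      · exact hind v hv a ha hva
    have hx := hnot x ((hover' x).2 (.inl rfl))
    have hy := hnot y ((hover' y).2 (.inr rfl))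
    have hn : T.card + 2 ≤ Fintype.card V := by
      have h := Finset.card_le_univ (insert x (insert y T))
      rwa [Finset.card_insert_of_notMem (by simp [hx, hxy]), Finset.card_insert_of_notMem hy] at h
    have h := ncard_edgeSet_le_of_independent hG hTn h3 hxy hx hy hind huniq
    rw [card_extremalEdges hx hy hxy hf] at h
    have hch := choose_two_succ (Fintype.card V - T.card)
    obtain ⟨h1, h2⟩ := h
    refine ⟨hn, by omega, fun hb => ?_⟩
    have := h2 hb
    omega
  · right
    push Not at hind
    obtain ⟨u, hu, v, hv, huv⟩ := hind
    have hpair : ∀ u ∈ T, ∀ v ∈ T, G.Adj u v → s(u, v) = s(x, y) := by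
      intro u hu v hv huv
      have h1 := (hover' u).1 ⟨u, hu, v, hv, huv.ne, .inl rfl, .inr huv⟩
      have h2 := (hover' v).1 ⟨u, hu, v, hv, huv.ne, .inr huv.symm, .inl rfl⟩
      have := huv.ne
      rw [Sym2.eq_iff]
      grind
    have hxyT : x ∈ T ∧ y ∈ T := by
      have := hpair u hu v hv huv
      rw [Sym2.eq_iff] at this
      grind
    exact ncard_edgeSet_le_of_adj_pair hpair fun v hv => huniq v hv
      (fun e => hv (e ▸ hxyT.1)) (fun e => hv (e ▸ hxyT.2))

end UpperBound

lemma two_mul_add_choose_antitone {n j s : ℕ} (h : j ≤ s) (hj : 2 ≤ j) (hs : s + 2 ≤ n) :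
    2 * (s - 2) + (n - s + 1).choose 2 ≤ 2 * (j - 2) + (n - j + 1).choose 2 := by
  induction s, h using Nat.le_induction with
  | base => exact le_rfl
  | succ s hjs ih =>
    have h1 := ih (by omega)
    have h2 := choose_two_succ (n - s)
    rw [show n - (s + 1) + 1 = n - s by omega]
    omega

lemma exists_graph_fin_nonadj_pair {n r : ℕ} (hr : 2 ≤ r) (hn : r + 5 ≤ n)
    (hrn : 2 * r + 2 ≤ n) : ∃ G : SimpleGraph (Fin n),
      G.edgeSet.ncard = 2 * (r - 2) + (n - r + 1).choose 2 + 1 ∧ crNum G = 2 ∧ gammaCR G = r := by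
  set S : Finset (Fin n) := Finset.univ.filter fun v => v.val < r with hS
  have hmem : ∀ v : Fin n, v ∈ S ↔ v.val < r := by simp [hS]
  have hcard : S.card = r := by
    rw [hS, Fin.card_filter_val_lt, min_eq_right (by omega)]
  have hx : (⟨r, by omega⟩ : Fin n) ∉ S := by simp [hS]
  have hy : (⟨r + 1, by omega⟩ : Fin n) ∉ S := by simp [hS]
  have hxy : (⟨r, by omega⟩ : Fin n) ≠ ⟨r + 1, by omega⟩ := by simp
  have hlt : ∀ v : Fin n, (v.val - (r + 2)) % r < r := fun v => Nat.mod_lt _ (by omega)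
  set f : Fin n → Fin n := fun v =>
    ⟨(v.val - (r + 2)) % r, (hlt v).trans (by omega)⟩ with hfdef
  have hf : ∀ v, f v ∈ S := fun v => (hmem _).2 (hlt v)
  obtain ⟨G, hG, hG2⟩ := exists_graph_nonadj_pair hx hy hxy hf (by omega)
    (by rw [Fintype.card_fin]; omega) (by
      intro s hs
      rw [hmem] at hs
      refine ⟨⟨s.val + (r + 2), by omega⟩, ?_, ?_, ?_, ?_⟩
      · rw [hmem]
        simp
        omega
      · rw [Ne, Fin.ext_iff]
        simp
        omega
      · rw [Ne, Fin.ext_iff]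
        simp
        omega
      · simp [hfdef, Nat.mod_eq_of_lt hs])
  rw [card_extremalEdges hx hy hxy hf, hcard, Fintype.card_fin] at hG
  have hch := choose_two_succ (n - r)
  exact ⟨G, by omega, hcard ▸ hG2⟩

lemma exists_graph_fin_adj_pair {n r w : ℕ} (hr : 2 ≤ r) (hn : r + 5 ≤ n) (hw : 1 ≤ w)
    (hwn : w + 5 ≤ n) : ∃ G : SimpleGraph (Fin n),
      G.edgeSet.ncard + w = 2 * (r - 2) + (n - r + 1).choose 2 + 1 ∧
        crNum G = 2 ∧ gammaCR G = r := by
  set S : Finset (Fin n) := Finset.univ.filter fun v => v.val < r with hS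
  have hmem : ∀ v : Fin n, v ∈ S ↔ v.val < r := by simp [hS]
  have hcard : S.card = r := by
    rw [hS, Fin.card_filter_val_lt, min_eq_right (by omega)]
  let x : Fin n := ⟨r, by omega⟩
  let y : Fin n := ⟨r + 1, by omega⟩
  let z₀ : Fin n := ⟨r + 2, by omega⟩
  let e : Fin n := ⟨r + 3, by omega⟩
  let s₁ : Fin n := ⟨0, by omega⟩
  let s₂ : Fin n := ⟨1, by omega⟩
  have hU : n ≤ (Finset.univ \ {x, y, z₀, s₁, s₂} : Finset (Fin n)).card + 5 := by
    have h1 := Finset.card_le_card_sdiff_add_card (s := Finset.univ) (t := {x, y, z₀, s₁, s₂})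
    have h2 : ({x, y, z₀, s₁, s₂} : Finset (Fin n)).card ≤ 5 := Finset.card_le_five
    rw [Finset.card_univ, Fintype.card_fin] at h1
    omega
  obtain ⟨W, heW, hWU, hW⟩ := Finset.exists_subsuperset_card_eq (n := w)
    (s := {e}) (t := Finset.univ \ {x, y, z₀, s₁, s₂}) (by
      rw [Finset.singleton_subset_iff]
      simp [x, y, z₀, s₁, s₂, e]) (by simpa using hw) (by omega)
  have hnW : ∀ v ∈ ({x, y, z₀, s₁, s₂} : Finset (Fin n)), v ∉ W := fun v hv hvW =>
    (Finset.mem_sdiff.1 (hWU hvW)).2 hv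
  have hx : x ∉ S := by simp [hmem, x]
  have hy : y ∉ S := by simp [hmem, y]
  have hxy : x ≠ y := by simp [x, y]
  have h1 : s₁ ∈ S := (hmem _).2 (by simp only [s₁]; omega)
  have h2 : s₂ ∈ S := (hmem _).2 (by simp only [s₂]; omega)
  obtain ⟨G, hG, hG2⟩ := exists_graph_adj_pair (z₀ := z₀) (s₁ := s₁) (s₂ := s₂) (e := e) (W := W)
    hx hy hxy (by rw [Fintype.card_fin]; omega) h1 h2 (by simp [s₁, s₂]) (by simp [hmem, z₀])
    (by simp [x, z₀]) (by simp [y, z₀]) (heW (Finset.mem_singleton_self e)) (by simp [hmem, e])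
    (hnW _ (by simp)) (hnW _ (by simp)) (hnW _ (by simp)) (hnW _ (by simp)) (hnW _ (by simp))
  rw [card_extremalEdges hx hy hxy (fun v => by split_ifs <;> assumption), hcard,
    Fintype.card_fin] at hG
  have hch := choose_two_succ (n - r)
  exact ⟨G, by omega, hcard ▸ hG2⟩

theorem D_n_two_m_large (n m r : ℕ) (hn : 8 ≤ n) (hm : 2 * (n - 6) + 10 < m)
    (A : ℕ → ℕ) (hA : ∀ j : ℕ, A j = 2 * (j - 2) + (n - j + 1).choose 2)
    (hr : (A (r + 1) + 1 < m ∧ m ≤ A r + 1 ∧ 2 ≤ r ∧ r < (n - 2) / 2) ∨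
          (A (r + 1) < m ∧ m ≤ A r + 1 ∧ r = (n - 2) / 2) ∨
          (A (r + 1) < m ∧ m ≤ A r ∧ (n - 2) / 2 < r ∧ r ≤ n - 5)) :
    IsMaxGamma n m r := by
  have hr2 : 2 ≤ r := by omega
  have hrn : r + 5 ≤ n := by omega
  constructor
  · intro V _ G hV hE hG
    by_contra! hlt
    obtain ⟨hle, ⟨hs, h1, h2⟩ | h1⟩ := ncard_edgeSet_le_of_crNum_eq_two hG (by omega)
    · have hmono := two_mul_add_choose_antitone (n := n) (j := r + 1) (s := gammaCR G) hlt
        (by omega) (by omega)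
      rw [← hA (r + 1)] at hmono
      rw [hV, hE] at h1 h2
      by_cases hb : n < 2 * gammaCR G + 2
      · have := h2 hb
        omega
      · omega
    · have hmono := Nat.choose_le_choose 2 (show n - gammaCR G + 1 ≤ n - (r + 1) + 1 by omega)
      rw [hV, hE] at h1
      have := hA (r + 1)
      omega
  · have hstep : A (r + 1) + (n - r) = A r + 2 := by
      have hch := choose_two_succ (n - r)
      rw [hA, hA, show n - (r + 1) + 1 = n - r by omega]
      omega
    by_cases htop : m = A r + 1
    · obtain ⟨G, hG, hG2⟩ := exists_graph_fin_nonadj_pair hr2 hrn (by omega)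
      exact ⟨G, by rw [hG, htop, hA], hG2⟩
    · obtain ⟨G, hG, hG2⟩ := exists_graph_fin_adj_pair (w := A r + 1 - m) hr2 hrn (by omega)
        (by omega)
      have := hA r
      exact ⟨G, by omega, hG2⟩
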